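/- There is a universal constant C > 0 such that for every pure strategy S for G_Rad^{(n)}: ω(S) ≤ ‖𝔼_ε Φ^i_S(ε)‖_op + C · σ^i_S · T2^{(n²)}(L), where L is the space of linear maps from ℂ^k ⊗ ℂ^{k̃} to ℂ^r ⊗ ℂ^r equipped with the operator norm. -/

import Mathlib

open scoped BigOperators

noncomputable section

abbrev ES (ι : Type) := EuclideanSpace ℂ ι

def sgn (b : Bool) : ℂ := if b then 1 else -1

def sgnR (b : Bool) : ℝ := if b then 1 else -1

/-- Uniform average of a real-valued function over a finite type. -/
def Eavg {α : Type} [Fintype α] (f : α → ℝ) : ℝ := (∑ x, f x) / (Fintype.card α : ℝ)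

/-- Uniform average of a vector-valued function over a finite type. -/
def EavgV {α : Type} [Fintype α] {X : Type} [AddCommGroup X] [Module ℂ X] (f : α → X) : X :=
  (Fintype.card α : ℂ)⁻¹ • ∑ x, f x

/-- The matrix of a continuous linear map between Euclidean spaces. -/
def matOf {ι κ : Type} [Fintype ι] [Fintype κ] [DecidableEq ι] (f : ES ι →L[ℂ] ES κ) :
    Matrix κ ι ℂ := Matrix.toEuclideanLin.symm (f : ES ι →ₗ[ℂ] ES κ)

/-- The continuous linear map between Euclidean spaces given by a matrix. -/
def ofMat {ι κ : Type} [Fintype ι] [Fintype κ] [DecidableEq ι] (M : Matrix κ ι ℂ) :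
    ES ι →L[ℂ] ES κ := LinearMap.toContinuousLinearMap (Matrix.toEuclideanLin M)

/-- Tensor product of two (continuous) linear maps between Euclidean spaces, realized
via the Kronecker product of their matrices. -/
def tensorCLM {ι₁ ι₂ κ₁ κ₂ : Type} [Fintype ι₁] [Fintype ι₂] [Fintype κ₁] [Fintype κ₂]
    [DecidableEq ι₁] [DecidableEq ι₂]
    (f : ES ι₁ →L[ℂ] ES κ₁) (g : ES ι₂ →L[ℂ] ES κ₂) :
    ES (ι₁ × ι₂) →L[ℂ] ES (κ₁ × κ₂) :=
  ofMat (Matrix.kroneckerMap (· * ·) (matOf f) (matOf g))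

/-- The isometry `ℂ^k → ℂ^n ⊗ ℂ^n ⊗ ℂ^k`, `x ↦ e_i ⊗ e_j ⊗ x`. -/
def embedAB {n k : ℕ} (i j : Fin n) : ES (Fin k) →L[ℂ] ES (Fin n × Fin n × Fin k) :=
  ofMat (Matrix.of fun p c => if p.1 = i ∧ p.2.1 = j ∧ p.2.2 = c then 1 else 0)

/-- `V|ij⟩ : ℂ^k → ℂ^{k̃}`, the map `x ↦ V(e_i ⊗ e_j ⊗ x)`. -/
def Vij {n k k' : ℕ} (V : ES (Fin n × Fin n × Fin k) →L[ℂ] ES (Fin k')) (i j : Fin n) :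
    ES (Fin k) →L[ℂ] ES (Fin k') := V.comp (embedAB i j)

/-- `e_i^* ⊗ Id : ℂ^n ⊗ ℂ^r → ℂ^r`. -/
def proj {n r : ℕ} (i : Fin n) : ES (Fin n × Fin r) →L[ℂ] ES (Fin r) :=
  ofMat (Matrix.of fun s p => if p.1 = i ∧ p.2 = s then 1 else 0)

/-- A pure strategy for the game `G_Rad^{(n)}` with dimensions `k, k', r`. -/
structure PureStrategy (n k k' r : ℕ) where
  V : ES (Fin n × Fin n × Fin k) →L[ℂ] ES (Fin k')
  W : ((Fin n × Fin n) → Bool) → ES (Fin k) →L[ℂ] ES (Fin k')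
  Vt : ((Fin n × Fin n) → Bool) → ES (Fin k') →L[ℂ] ES (Fin n × Fin r)
  Wt : ((Fin n × Fin n) → Bool) → ES (Fin k') →L[ℂ] ES (Fin n × Fin r)
  φ : ES (Fin k × Fin k)
  hV : ‖V‖ ≤ 1
  hW : ∀ ε, ‖W ε‖ ≤ 1
  hVt : ∀ ε, ‖Vt ε‖ ≤ 1
  hWt : ∀ ε, ‖Wt ε‖ ≤ 1
  hφ : ‖φ‖ = 1

/-- The value `ω(S)` of a pure strategy in `G_Rad^{(n)}`. -/
def value {n k k' r : ℕ} (S : PureStrategy n k k' r) : ℝ :=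
  Eavg fun ε => ‖((n : ℂ) ^ 2)⁻¹ • ∑ ij : Fin n × Fin n, sgn (ε ij) •
    (tensorCLM ((proj ij.1).comp (S.Vt ε)) ((proj ij.2).comp (S.Wt ε)))
      ((tensorCLM (Vij S.V ij.1 ij.2) (S.W ε)) S.φ)‖ ^ 2

/-- The assignment `Φ^i_S : {−1,1}^{n×n} → B(ℂ^k ⊗ ℂ^{k̃}, ℂ^r ⊗ ℂ^r)`. -/
def PhiI {n k k' r : ℕ} (S : PureStrategy n k k' r) (ε : (Fin n × Fin n) → Bool) :
    ES (Fin k × Fin k') →L[ℂ] ES (Fin r × Fin r) :=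
  ((n : ℂ) ^ 2)⁻¹ • ∑ ij : Fin n × Fin n, sgn (ε ij) •
    ((tensorCLM ((proj ij.1).comp (S.Vt ε)) ((proj ij.2).comp (S.Wt ε))).comp
      (tensorCLM (Vij S.V ij.1 ij.2) (ContinuousLinearMap.id ℂ (ES (Fin k')))))

/-- Flip the `p`-th sign of `ε`. -/
def flipAt {ι : Type} [DecidableEq ι] (ε : ι → Bool) (p : ι) : ι → Bool :=
  Function.update ε p (!(ε p))

/-- The regularity parameter `σ_Φ` of a map on the Boolean hypercube with values in a
normed space; `‖∂_pΦ(ε)‖ = ‖Φ(ε) − Φ(ε̄^p)‖/2`. -/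
def sigma {ι : Type} [Fintype ι] [DecidableEq ι] {X : Type} [NormedAddCommGroup X]
    (Φ : (ι → Bool) → X) : ℝ :=
  Real.log (Fintype.card ι) *
    Eavg fun ε => Real.sqrt (∑ p : ι, (‖Φ ε - Φ (flipAt ε p)‖ / 2) ^ 2)

/-- The type-2 constant with `m` vectors of a normed space. -/
def T2With (m : ℕ) (X : Type) [NormedAddCommGroup X] [NormedSpace ℝ X] : ℝ :=
  sInf {T : ℝ | 0 ≤ T ∧ ∀ x : Fin m → X,
    Real.sqrt (Eavg fun ε : Fin m → Bool => ‖∑ i, sgnR (ε i) • x i‖ ^ 2)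
      ≤ T * Real.sqrt (∑ i, ‖x i‖ ^ 2)}

/-- `ĥ : ℂ^n ⊗ ℂ^{k̃} → ℂ^{r'}` determined by `ĥ(e_i ⊗ y) = (e_i^* ⊗ Id)(h y)`. -/
def hat {n k' r' : ℕ} (h : ES (Fin k') →L[ℂ] ES (Fin n × Fin r')) :
    ES (Fin n × Fin k') →L[ℂ] ES (Fin r') :=
  ofMat (Matrix.of fun s p => matOf h (p.1, s) p.2)

/-- The norm `N` on `(ℂ^n ⊗ ℂ^{k̃}) ⊗ (ℂ^n ⊗ ℂ^{k̃})`. -/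
def Nnorm {n k' : ℕ} (t : ES ((Fin n × Fin k') × (Fin n × Fin k'))) : ℝ :=
  sSup {s : ℝ | ∃ (r' : ℕ) (h g : ES (Fin k') →L[ℂ] ES (Fin n × Fin r')),
    ‖h‖ ≤ 1 ∧ ‖g‖ ≤ 1 ∧ s = ‖(tensorCLM (hat h) (hat g)) t‖}

/-- `v ↦ e_i ⊗ e_j ⊗ v`, reordered into `(ℂ^n ⊗ ℂ^{k̃}) ⊗ (ℂ^n ⊗ ℂ^{k̃})`. -/
def embedPair {n k' : ℕ} (i j : Fin n) :
    ES (Fin k' × Fin k') →L[ℂ] ES ((Fin n × Fin k') × (Fin n × Fin k')) :=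
  ofMat (Matrix.of fun p q => if p.1.1 = i ∧ p.2.1 = j ∧ p.1.2 = q.1 ∧ p.2.2 = q.2 then 1 else 0)

/-- The assignment `Φ^{ii}_S : {−1,1}^{n×n} → (ℂ^n ⊗ ℂ^{k̃}) ⊗ (ℂ^n ⊗ ℂ^{k̃})`. -/
def PhiII {n k k' r : ℕ} (S : PureStrategy n k k' r) (ε : (Fin n × Fin n) → Bool) :
    ES ((Fin n × Fin k') × (Fin n × Fin k')) :=
  ((n : ℂ) ^ 2)⁻¹ • ∑ ij : Fin n × Fin n, sgn (ε ij) •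
    embedPair ij.1 ij.2 ((tensorCLM (Vij S.V ij.1 ij.2) (S.W ε)) S.φ)

set_option linter.unusedSectionVars false

/-! ### Pisier-type inequality on the cube -/

section cube

variable {ι : Type} [Fintype ι] [DecidableEq ι] {X : Type} [NormedAddCommGroup X] [NormedSpace ℝ X]

/-- flip the coordinates of `x` in `A` along `η` -/
def shift (A : Finset ι) (η x : ι → Bool) : ι → Bool :=
  fun i => if i ∈ A then xor (x i) (η i) else x i

lemma shift_shift (A : Finset ι) (η x : ι → Bool) : shift A η (shift A η x) = x := by
  funext i
  by_cases h : i ∈ A <;> simp [shift, h]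

lemma flipAt_flipAt (η : ι → Bool) (i : ι) : flipAt (flipAt η i) i = η := by
  funext j
  by_cases h : j = i
  · subst h; simp [flipAt]
  · simp [flipAt, h]

lemma sum_shift {M : Type} [AddCommMonoid M] (A : Finset ι) (η : ι → Bool) (g : (ι → Bool) → M) :
    ∑ x, g (shift A η x) = ∑ x, g x :=
  Equiv.sum_comp (⟨shift A η, shift A η, shift_shift A η, shift_shift A η⟩ :
    (ι → Bool) ≃ (ι → Bool)) g

lemma sum_flip {M : Type} [AddCommMonoid M] (i : ι) (g : (ι → Bool) → M) :
    ∑ x, g (flipAt x i) = ∑ x, g x :=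
  Equiv.sum_comp (⟨fun x => flipAt x i, fun x => flipAt x i, fun x => flipAt_flipAt x i,
    fun x => flipAt_flipAt x i⟩ : (ι → Bool) ≃ (ι → Bool)) g

/-- unnormalised average of `f` over the coordinates in `A` -/
def avgOn (A : Finset ι) (f : (ι → Bool) → X) (x : ι → Bool) : X := ∑ η, f (shift A η x)

lemma avgOn_empty (f : (ι → Bool) → X) (x : ι → Bool) :
    avgOn ∅ f x = (Fintype.card (ι → Bool) : ℝ) • f x := by
  have : ∀ η : ι → Bool, shift ∅ η x = x := fun η => by funext i; simp [shift]
  simp only [avgOn, this, Finset.sum_const, Finset.card_univ]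
  rw [Nat.cast_smul_eq_nsmul]

lemma avgOn_univ (f : (ι → Bool) → X) (x : ι → Bool) :
    avgOn Finset.univ f x = ∑ y, f y := by
  have : ∀ η : ι → Bool, shift Finset.univ η x = shift Finset.univ x η := fun η => by
    funext i; simp [shift, Bool.xor_comm]
  simp only [avgOn, this]
  exact sum_shift _ _ _

lemma avgOn_erase (A : Finset ι) (f : (ι → Bool) → X) (x : ι → Bool) (i : ι) (hi : i ∈ A) :
    avgOn (A.erase i) f x - avgOn A f x =
      - ∑ η : ι → Bool, sgnR (η i) •
        ((1/2 : ℝ) • (f (shift A η x) - f (flipAt (shift A η x) i))) := by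
  have h1 : ∀ η, flipAt (shift A η x) i = shift A (flipAt η i) x := by
    intro η
    funext j
    by_cases h : j = i
    · subst h; simp [flipAt, shift, hi]
    · simp [flipAt, shift, h]
  have h2 : ∀ η : ι → Bool, f (shift (A.erase i) η x) =
      if η i then f (shift A (flipAt η i) x) else f (shift A η x) := by
    intro η
    split_ifs with h
    · congr 1
      funext j
      by_cases hj : j = i
      · subst hj; simp [shift, flipAt, hi, h]
      · simp [shift, flipAt, hj]
    · congr 1
      funext j
      by_cases hj : j = i
      · subst hj; simp [shift, hi, h]
      · simp [shift, hj]
  have h3 : ∑ η : ι → Bool, f (shift A (flipAt η i) x) = ∑ η, f (shift A η x) :=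
    sum_flip i (fun η => f (shift A η x))
  have h4 : ∀ η : ι → Bool, f (shift (A.erase i) η x) - f (shift A η x) + sgnR (η i) •
        ((1/2 : ℝ) • (f (shift A η x) - f (flipAt (shift A η x) i))) =
        (1/2 : ℝ) • (f (shift A (flipAt η i) x) - f (shift A η x)) := by
    intro η
    rw [h1, h2]
    cases h : η i <;> simp only [sgnR] <;> simp <;> module
  rw [eq_neg_iff_add_eq_zero]
  unfold avgOn
  rw [← Finset.sum_sub_distrib, ← Finset.sum_add_distrib, Finset.sum_congr rfl (fun η _ => h4 η),
    ← Finset.smul_sum, Finset.sum_sub_distrib, h3]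
  simp

/-- the type 2 inequality in `L¹` form, for an arbitrary index type -/
def TypeTwo (ι : Type) [Fintype ι] [DecidableEq ι] (X : Type) [NormedAddCommGroup X] [NormedSpace ℝ X] (T : ℝ) :
    Prop :=
  ∀ y : ι → X, ∑ η : ι → Bool, ‖∑ i, sgnR (η i) • y i‖ ≤
    (Fintype.card (ι → Bool) : ℝ) * (T * Real.sqrt (∑ i, ‖y i‖ ^ 2))

lemma step_bound {T : ℝ} (hT0 : 0 ≤ T) (hT : TypeTwo ι X T) (f : (ι → Bool) → X) (A : Finset ι) :
    ∑ x, ‖∑ i ∈ A, (avgOn (A.erase i) f x - avgOn A f x)‖ ≤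
      (Fintype.card (ι → Bool) : ℝ) *
        (T * ∑ x, Real.sqrt (∑ p : ι, (‖f x - f (flipAt x p)‖ / 2) ^ 2)) := by
  set d : (ι → Bool) → ι → X := fun z i => if i ∈ A then (1/2 : ℝ) • (f z - f (flipAt z i)) else 0
    with hd
  have h1 : ∀ x, ∑ i ∈ A, (avgOn (A.erase i) f x - avgOn A f x) =
      - ∑ η : ι → Bool, ∑ i, sgnR (η i) • d (shift A η x) i := by
    intro x
    rw [Finset.sum_congr rfl (fun i hi => avgOn_erase A f x i hi), Finset.sum_neg_distrib,
      Finset.sum_comm]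
    congr 1
    refine Finset.sum_congr rfl fun η _ => ?_
    simp only [hd, smul_ite, smul_zero, Finset.sum_ite_mem, Finset.univ_inter]
  calc ∑ x, ‖∑ i ∈ A, (avgOn (A.erase i) f x - avgOn A f x)‖
      ≤ ∑ x, ∑ η : ι → Bool, ‖∑ i, sgnR (η i) • d (shift A η x) i‖ := by
        refine Finset.sum_le_sum fun x _ => ?_
        rw [h1, norm_neg]
        exact norm_sum_le _ _
    _ = ∑ z, ∑ η : ι → Bool, ‖∑ i, sgnR (η i) • d z i‖ := by
        rw [Finset.sum_comm]
        conv_rhs => rw [Finset.sum_comm]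
        refine Finset.sum_congr rfl fun η _ => ?_
        exact sum_shift A η (fun z => ‖∑ i, sgnR (η i) • d z i‖)
    _ ≤ ∑ z, (Fintype.card (ι → Bool) : ℝ) *
        (T * Real.sqrt (∑ p : ι, (‖f z - f (flipAt z p)‖ / 2) ^ 2)) := by
        refine Finset.sum_le_sum fun z _ => (hT (d z)).trans ?_
        gcongr with p
        simp only [hd]
        split_ifs
        · rw [norm_smul]; norm_num; linarith
        · simp; positivity
    _ = _ := by rw [Finset.mul_sum, Finset.mul_sum]; 

lemma pisier_aux {T : ℝ} (hT0 : 0 ≤ T) (hT : TypeTwo ι X T) (f : (ι → Bool) → X) :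
    ∀ (k : ℕ) (A : Finset ι), A.card = k →
    ∑ x, ‖avgOn ∅ f x - avgOn A f x‖ ≤ (harmonic k : ℝ) * ((Fintype.card (ι → Bool) : ℝ) *
        (T * ∑ x, Real.sqrt (∑ p : ι, (‖f x - f (flipAt x p)‖ / 2) ^ 2))) := by
  intro k
  induction k with
  | zero =>
    intro A hA
    rw [Finset.card_eq_zero] at hA
    subst hA
    simp
  | succ k ih =>
    intro A hA
    set K := (Fintype.card (ι → Bool) : ℝ) *
        (T * ∑ x, Real.sqrt (∑ p : ι, (‖f x - f (flipAt x p)‖ / 2) ^ 2)) with hK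
    have hk : (0 : ℝ) < (k + 1 : ℕ) := by positivity
    have key : ((k + 1 : ℕ) : ℝ) * ∑ x, ‖avgOn ∅ f x - avgOn A f x‖ ≤
        ((k + 1 : ℕ) : ℝ) * ((harmonic k : ℝ) * K) + K := by
      calc ((k + 1 : ℕ) : ℝ) * ∑ x, ‖avgOn ∅ f x - avgOn A f x‖
          = ∑ x, ‖∑ i ∈ A, (avgOn ∅ f x - avgOn (A.erase i) f x) +
              ∑ i ∈ A, (avgOn (A.erase i) f x - avgOn A f x)‖ := by
            rw [Finset.mul_sum]
            refine Finset.sum_congr rfl fun x _ => ?_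
            rw [← Finset.sum_add_distrib]
            simp only [sub_add_sub_cancel, Finset.sum_const, hA]
            rw [← Nat.cast_smul_eq_nsmul ℝ, norm_smul, Real.norm_of_nonneg hk.le]
        _ ≤ ∑ x, ((∑ i ∈ A, ‖avgOn ∅ f x - avgOn (A.erase i) f x‖) +
              ‖∑ i ∈ A, (avgOn (A.erase i) f x - avgOn A f x)‖) := by
            refine Finset.sum_le_sum fun x _ => (norm_add_le _ _).trans ?_
            gcongr
            exact norm_sum_le _ _
        _ = (∑ i ∈ A, ∑ x, ‖avgOn ∅ f x - avgOn (A.erase i) f x‖) +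
              ∑ x, ‖∑ i ∈ A, (avgOn (A.erase i) f x - avgOn A f x)‖ := by
            rw [Finset.sum_add_distrib, Finset.sum_comm]
        _ ≤ (∑ i ∈ A, (harmonic k : ℝ) * K) + K := by
            refine add_le_add (Finset.sum_le_sum fun i hi => ?_) (step_bound hT0 hT f A)
            apply ih
            rw [Finset.card_erase_of_mem hi, hA]; simp
        _ = _ := by simp [hA]
    rw [harmonic_succ]
    push_cast at key ⊢
    have hk' : (0 : ℝ) < (k : ℝ) + 1 := by positivity
    have : ∑ x, ‖avgOn ∅ f x - avgOn A f x‖ ≤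
      (((k : ℝ) + 1) * ((harmonic k : ℝ) * K) + K) / ((k : ℝ) + 1) := by
      rw [le_div_iff₀ hk']; linarith
    refine this.trans (le_of_eq ?_)
    field_simp

/-- Pisier's inequality combined with type 2, `L¹` version. -/
lemma pisier {T : ℝ} (hT0 : 0 ≤ T) (hT : TypeTwo ι X T) (hc : 4 ≤ Fintype.card ι)
    (f : (ι → Bool) → X) :
    Eavg (fun x => ‖f x‖) ≤ ‖(Fintype.card (ι → Bool) : ℝ)⁻¹ • ∑ x, f x‖ + 2 * sigma f * T := by
  set N : ℝ := (Fintype.card (ι → Bool) : ℝ) with hN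
  have hNpos : 0 < N := by rw [hN]; exact_mod_cast Fintype.card_pos
  set R := ∑ x, Real.sqrt (∑ p : ι, (‖f x - f (flipAt x p)‖ / 2) ^ 2) with hR
  have hR0 : 0 ≤ R := Finset.sum_nonneg fun _ _ => Real.sqrt_nonneg _
  have h := pisier_aux hT0 hT f (Fintype.card ι) Finset.univ Finset.card_univ
  simp only [avgOn_empty, avgOn_univ] at h
  rw [← hN, ← hR] at h
  have hlog : (harmonic (Fintype.card ι) : ℝ) ≤ 2 * Real.log (Fintype.card ι) := by
    have h1 := harmonic_le_one_add_log (Fintype.card ι)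
    have h2 : (1 : ℝ) ≤ Real.log (Fintype.card ι) := by
      rw [Real.le_log_iff_exp_le (by positivity)]
      have : (4 : ℝ) ≤ Fintype.card ι := by exact_mod_cast hc
      have := Real.exp_one_lt_d9
      linarith
    linarith
  have h5 : ∑ x, ‖N • f x‖ ≤ ∑ x, (‖N • f x - ∑ y, f y‖ + ‖∑ y, f y‖) := by
    refine Finset.sum_le_sum fun x _ => ?_
    have := norm_add_le (N • f x - ∑ y, f y) (∑ y, f y)
    simpa using this
  rw [Finset.sum_add_distrib, Finset.sum_const, Finset.card_univ, nsmul_eq_mul, ← hN] at h5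
  simp only [norm_smul, Real.norm_of_nonneg hNpos.le] at h5
  rw [← Finset.mul_sum] at h5
  have h6 : (harmonic (Fintype.card ι) : ℝ) * (N * (T * R)) ≤
    2 * Real.log (Fintype.card ι) * (N * (T * R)) := by gcongr
  have h7 : N * ∑ x, ‖f x‖ ≤ N * (2 * Real.log (Fintype.card ι) * (T * R) + ‖∑ y, f y‖) := by
    nlinarith
  have h8 := le_of_mul_le_mul_left h7 hNpos
  unfold Eavg sigma Eavg
  rw [← hR, ← hN, norm_smul, norm_inv, Real.norm_of_nonneg hNpos.le, div_le_iff₀ hNpos]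
  refine h8.trans (le_of_eq ?_)
  field_simp
  ring

end cube

/-! ### The type 2 constant -/

lemma T2With_spec (m : ℕ) (X : Type) [NormedAddCommGroup X] [NormedSpace ℝ X] :
    0 ≤ T2With m X ∧ ∀ x : Fin m → X,
    Real.sqrt (Eavg fun ε : Fin m → Bool => ‖∑ i, sgnR (ε i) • x i‖ ^ 2)
      ≤ T2With m X * Real.sqrt (∑ i, ‖x i‖ ^ 2) := by
  have hne : {T : ℝ | 0 ≤ T ∧ ∀ x : Fin m → X,
    Real.sqrt (Eavg fun ε : Fin m → Bool => ‖∑ i, sgnR (ε i) • x i‖ ^ 2)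
      ≤ T * Real.sqrt (∑ i, ‖x i‖ ^ 2)}.Nonempty := by
    refine ⟨Real.sqrt m, Real.sqrt_nonneg _, fun x => ?_⟩
    rw [← Real.sqrt_mul (by positivity)]
    apply Real.sqrt_le_sqrt
    unfold Eavg
    have hNpos : (0 : ℝ) < Fintype.card (Fin m → Bool) := by exact_mod_cast Fintype.card_pos
    rw [div_le_iff₀ hNpos]
    have : ∀ ε : Fin m → Bool, ‖∑ i, sgnR (ε i) • x i‖ ^ 2 ≤ m * ∑ i, ‖x i‖ ^ 2 := by
      intro ε
      have h1 : ‖∑ i, sgnR (ε i) • x i‖ ≤ ∑ i, ‖x i‖ := by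
        refine (norm_sum_le _ _).trans (Finset.sum_le_sum fun i _ => ?_)
        rw [norm_smul]
        cases ε i <;> simp [sgnR]
      have h2 := sq_sum_le_card_mul_sum_sq (s := (Finset.univ : Finset (Fin m))) (f := fun i => ‖x i‖)
      simp only [Finset.card_univ, Fintype.card_fin] at h2
      exact (pow_le_pow_left₀ (norm_nonneg _) h1 2).trans h2
    refine (Finset.sum_le_sum fun ε _ => this ε).trans (le_of_eq ?_)
    rw [Finset.sum_const, Finset.card_univ, nsmul_eq_mul, mul_comm]
  refine ⟨Real.sInf_nonneg fun T hT => hT.1, fun x => ?_⟩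
  rcases (Real.sqrt_nonneg (∑ i, ‖x i‖ ^ 2)).eq_or_lt with h | h
  · obtain ⟨T, hT⟩ := hne
    have := hT.2 x
    rw [← h] at this ⊢
    simpa using this
  · rw [← div_le_iff₀ h]
    exact le_csInf hne fun T hT => (div_le_iff₀ h).2 (hT.2 x)

lemma typeTwo_of_T2With {ι : Type} [Fintype ι] [DecidableEq ι] (m : ℕ) (hm : Fintype.card ι = m)
    (X : Type) [NormedAddCommGroup X] [NormedSpace ℝ X] : TypeTwo ι X (T2With m X) := by
  intro y
  let e : Fin m ≃ ι := (Fintype.equivFinOfCardEq hm).symm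
  have h := (T2With_spec m X).2 (y ∘ e)
  let E : (Fin m → Bool) ≃ (ι → Bool) := Equiv.arrowCongr e (Equiv.refl _)
  have hs : ∑ i, ‖(y ∘ e) i‖ ^ 2 = ∑ i, ‖y i‖ ^ 2 := Equiv.sum_comp e (fun i => ‖y i‖ ^ 2)
  have hx : ∑ ε : Fin m → Bool, ‖∑ i, sgnR (ε i) • (y ∘ e) i‖ ^ 2 =
      ∑ η : ι → Bool, ‖∑ i, sgnR (η i) • y i‖ ^ 2 := by
    rw [← Equiv.sum_comp E]
    refine Finset.sum_congr rfl fun ε _ => ?_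
    rw [← Equiv.sum_comp e (fun i => sgnR (E ε i) • y i)]
    simp [E, Equiv.arrowCongr]
  have hcard : Fintype.card (Fin m → Bool) = Fintype.card (ι → Bool) := Fintype.card_congr E
  unfold Eavg at h
  rw [hs, hx, hcard] at h
  set N : ℝ := (Fintype.card (ι → Bool) : ℝ) with hN
  have hNpos : 0 < N := by rw [hN]; exact_mod_cast Fintype.card_pos
  refine le_trans ?_ (mul_le_mul_of_nonneg_left h hNpos.le)
  have h2 := sq_sum_le_card_mul_sum_sq (s := (Finset.univ : Finset (ι → Bool)))
    (f := fun η => ‖∑ i, sgnR (η i) • y i‖)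
  rw [Finset.card_univ, ← hN] at h2
  rw [← div_le_iff₀' hNpos]
  apply Real.le_sqrt_of_sq_le
  rw [div_pow, div_le_div_iff₀ (by positivity) hNpos]
  nlinarith

/-! ### Tensor products -/

section tensor

variable {ι₁ ι₂ κ₁ κ₂ μ₁ μ₂ : Type} [Fintype ι₁] [Fintype ι₂] [Fintype κ₁] [Fintype κ₂]
  [Fintype μ₁] [Fintype μ₂]
  [DecidableEq ι₁] [DecidableEq ι₂] [DecidableEq κ₁] [DecidableEq κ₂]

lemma ofMat_apply {ι κ : Type} [Fintype ι] [Fintype κ] [DecidableEq ι] (M : Matrix κ ι ℂ)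
    (v : ES ι) (a : κ) : ofMat M v a = ∑ b, M a b * v b := by
  simp [ofMat, Matrix.toEuclideanLin, Matrix.toLpLin_apply, Matrix.mulVec, dotProduct]

lemma matOf_mul_apply {ι κ : Type} [Fintype ι] [Fintype κ] [DecidableEq ι] (f : ES ι →L[ℂ] ES κ)
    (v : ES ι) (a : κ) : f v a = ∑ b, matOf f a b * v b := by
  have : f = ofMat (matOf f) := by
    ext v : 1
    simp [ofMat, matOf]
  conv_lhs => rw [this]
  exact ofMat_apply _ _ _

lemma tensor_apply (f : ES ι₁ →L[ℂ] ES κ₁) (g : ES ι₂ →L[ℂ] ES κ₂) (v : ES (ι₁ × ι₂))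
    (a : κ₁ × κ₂) : tensorCLM f g v a =
      f (WithLp.toLp 2 fun b₁ => g (WithLp.toLp 2 fun b₂ => v (b₁, b₂)) a.2) a.1 := by
  rw [tensorCLM, ofMat_apply]
  simp only [matOf_mul_apply, Matrix.kroneckerMap_apply,
    Fintype.sum_prod_type, Finset.mul_sum, mul_assoc]

lemma tensor_apply' (f : ES ι₁ →L[ℂ] ES κ₁) (g : ES ι₂ →L[ℂ] ES κ₂) (v : ES (ι₁ × ι₂))
    (a : κ₁ × κ₂) : tensorCLM f g v a =
      g (WithLp.toLp 2 fun b₂ => f (WithLp.toLp 2 fun b₁ => v (b₁, b₂)) a.1) a.2 := by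
  rw [tensorCLM, ofMat_apply]
  simp only [matOf_mul_apply, Matrix.kroneckerMap_apply,
    Fintype.sum_prod_type, Finset.mul_sum]
  rw [Finset.sum_comm]
  refine Finset.sum_congr rfl fun _ _ => Finset.sum_congr rfl fun _ _ => by ring

lemma tensor_id_comp (f : ES ι₁ →L[ℂ] ES κ₁) (g : ES ι₂ →L[ℂ] ES κ₂) (v : ES (ι₁ × ι₂)) :
    tensorCLM f (ContinuousLinearMap.id ℂ (ES κ₂))
      (tensorCLM (ContinuousLinearMap.id ℂ (ES ι₁)) g v) = tensorCLM f g v := by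
  ext a
  simp only [tensor_apply, ContinuousLinearMap.id_apply]

lemma norm_id_tensor (g : ES ι₂ →L[ℂ] ES κ₂) (hg : ‖g‖ ≤ 1) (v : ES (ι₁ × ι₂)) :
    ‖tensorCLM (ContinuousLinearMap.id ℂ (ES ι₁)) g v‖ ≤ ‖v‖ := by
  rw [EuclideanSpace.norm_eq, EuclideanSpace.norm_eq]
  apply Real.sqrt_le_sqrt
  rw [Fintype.sum_prod_type, Fintype.sum_prod_type]
  refine Finset.sum_le_sum fun i _ => ?_
  simp only [tensor_apply, ContinuousLinearMap.id_apply]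
  have h := (g.le_of_opNorm_le hg (WithLp.toLp 2 fun b₂ => v (i, b₂)))
  rw [one_mul] at h
  have h2 := pow_le_pow_left₀ (norm_nonneg _) h 2
  rw [EuclideanSpace.norm_sq_eq, EuclideanSpace.norm_sq_eq] at h2
  exact h2

lemma norm_tensor_id (f : ES ι₁ →L[ℂ] ES κ₁) (hf : ‖f‖ ≤ 1) (v : ES (ι₁ × ι₂)) :
    ‖tensorCLM f (ContinuousLinearMap.id ℂ (ES ι₂)) v‖ ≤ ‖v‖ := by
  rw [EuclideanSpace.norm_eq, EuclideanSpace.norm_eq]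
  apply Real.sqrt_le_sqrt
  rw [Fintype.sum_prod_type_right, Fintype.sum_prod_type_right]
  refine Finset.sum_le_sum fun i _ => ?_
  simp only [tensor_apply', ContinuousLinearMap.id_apply]
  have h := (f.le_of_opNorm_le hf (WithLp.toLp 2 fun b₁ => v (b₁, i)))
  rw [one_mul] at h
  have h2 := pow_le_pow_left₀ (norm_nonneg _) h 2
  rw [EuclideanSpace.norm_sq_eq, EuclideanSpace.norm_sq_eq] at h2
  exact h2

lemma norm_tensor (f : ES ι₁ →L[ℂ] ES κ₁) (hf : ‖f‖ ≤ 1) (g : ES ι₂ →L[ℂ] ES κ₂) (hg : ‖g‖ ≤ 1)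
    (v : ES (ι₁ × ι₂)) : ‖tensorCLM f g v‖ ≤ ‖v‖ := by
  rw [← tensor_id_comp]
  exact (norm_tensor_id f hf _).trans (norm_id_tensor g hg v)

lemma opNorm_tensor (f : ES ι₁ →L[ℂ] ES κ₁) (hf : ‖f‖ ≤ 1) (g : ES ι₂ →L[ℂ] ES κ₂) (hg : ‖g‖ ≤ 1) :
    ‖tensorCLM f g‖ ≤ 1 := by
  refine ContinuousLinearMap.opNorm_le_bound _ zero_le_one fun v => ?_
  rw [one_mul]
  exact norm_tensor f hf g hg v

lemma opNorm_smul_comp (c : ℂ) (hc : ‖c‖ = 1) (g : ES κ₁ →L[ℂ] ES μ₁) (f : ES ι₁ →L[ℂ] ES κ₁)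
    (hg : ‖g‖ ≤ 1) (hf : ‖f‖ ≤ 1) : ‖c • g.comp f‖ ≤ 1 := by
  rw [norm_smul, hc, one_mul]
  exact (ContinuousLinearMap.opNorm_comp_le g f).trans (mul_le_one₀ hg (norm_nonneg _) hf)

lemma opNorm_sum {n : ℕ} (hn : 2 ≤ n) (F : Fin n × Fin n → (ES ι₁ →L[ℂ] ES κ₁))
    (h : ∀ ij, ‖F ij‖ ≤ 1) : ‖((n : ℂ) ^ 2)⁻¹ • ∑ ij, F ij‖ ≤ 1 := by
  rw [norm_smul]
  have hn' : (0 : ℝ) < n := by exact_mod_cast (by omega : 0 < n)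
  have h2 := (norm_sum_le _ _).trans (Finset.sum_le_sum fun ij (_ : ij ∈ Finset.univ) => h ij)
  simp only [Finset.sum_const, Finset.card_univ, Fintype.card_prod, Fintype.card_fin,
    nsmul_eq_mul, mul_one, Nat.cast_mul] at h2
  rw [norm_inv, norm_pow, Complex.norm_natCast, inv_mul_le_iff₀ (by positivity)]
  linarith [h2, sq (n : ℝ)]

end tensor

lemma norm_proj {n r : ℕ} (i : Fin n) : ‖(proj i : ES (Fin n × Fin r) →L[ℂ] ES (Fin r))‖ ≤ 1 := by
  refine ContinuousLinearMap.opNorm_le_bound _ zero_le_one fun v => ?_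
  rw [one_mul, EuclideanSpace.norm_eq, EuclideanSpace.norm_eq]
  apply Real.sqrt_le_sqrt
  have h : ∀ s, (proj i v : ES (Fin r)) s = v (i, s) := by
    intro s
    simp only [proj, ofMat_apply, Matrix.of_apply]
    rw [Finset.sum_eq_single (i, s)]
    · simp
    · rintro ⟨a, b⟩ _ hb
      rw [if_neg, zero_mul]
      rintro ⟨rfl, rfl⟩
      exact hb rfl
    · simp
  simp only [h]
  rw [Fintype.sum_prod_type]
  exact Finset.single_le_sum (f := fun j => ∑ s, ‖v (j, s)‖ ^ 2)
    (fun j _ => by positivity) (Finset.mem_univ i)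

lemma norm_embedAB {n k : ℕ} (i j : Fin n) :
    ‖(embedAB i j : ES (Fin k) →L[ℂ] ES (Fin n × Fin n × Fin k))‖ ≤ 1 := by
  refine ContinuousLinearMap.opNorm_le_bound _ zero_le_one fun v => ?_
  rw [one_mul, EuclideanSpace.norm_eq, EuclideanSpace.norm_eq]
  apply Real.sqrt_le_sqrt
  have h : ∀ p, (embedAB i j v : ES (Fin n × Fin n × Fin k)) p =
      if p.1 = i then (if p.2.1 = j then v p.2.2 else 0) else 0 := by
    intro p
    simp only [embedAB, ofMat_apply, Matrix.of_apply]
    by_cases h1 : p.1 = i <;> by_cases h2 : p.2.1 = j <;> simp [h1, h2]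
  simp only [h]
  rw [Fintype.sum_prod_type, Finset.sum_eq_single i, Fintype.sum_prod_type,
    Finset.sum_eq_single j]
  · simp
  · intro b _ hb; simp [hb]
  · simp
  · intro b _ hb; simp [hb]
  · simp

lemma norm_comp_le_one {ι κ μ : Type} [Fintype ι] [Fintype κ] [Fintype μ]
    (g : ES κ →L[ℂ] ES μ) (f : ES ι →L[ℂ] ES κ) (hg : ‖g‖ ≤ 1) (hf : ‖f‖ ≤ 1) : ‖g.comp f‖ ≤ 1 :=
  (ContinuousLinearMap.opNorm_comp_le g f).trans (mul_le_one₀ hg (norm_nonneg _) hf)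

lemma norm_PhiI_le {n k k' r : ℕ} (hn : 2 ≤ n) (S : PureStrategy n k k' r)
    (ε : (Fin n × Fin n) → Bool) : ‖PhiI S ε‖ ≤ 1 := by
  have hs : ∀ b, ‖sgn b‖ = 1 := by intro b; cases b <;> simp [sgn]
  unfold PhiI
  refine opNorm_sum hn _ fun ij => opNorm_smul_comp _ (hs _) _ _ ?_ ?_
  · have h1 := norm_comp_le_one (proj ij.1) (S.Vt ε) (norm_proj _) (S.hVt ε)
    have h2 := norm_comp_le_one (proj ij.2) (S.Wt ε) (norm_proj _) (S.hWt ε)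
    exact opNorm_tensor _ h1 _ h2
  · have h1 : ‖Vij S.V ij.1 ij.2‖ ≤ 1 :=
      norm_comp_le_one S.V (embedAB ij.1 ij.2) S.hV (norm_embedAB _ _)
    exact opNorm_tensor _ h1 _ ContinuousLinearMap.norm_id_le

lemma value_le {n k k' r : ℕ} (hn : 2 ≤ n) (S : PureStrategy n k k' r) :
    value S ≤ Eavg fun ε => ‖PhiI S ε‖ := by
  unfold value Eavg
  gcongr with ε
  beta_reduce
  have h : ((n : ℂ) ^ 2)⁻¹ • ∑ ij : Fin n × Fin n, sgn (ε ij) •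
    (tensorCLM ((proj ij.1).comp (S.Vt ε)) ((proj ij.2).comp (S.Wt ε)))
      ((tensorCLM (Vij S.V ij.1 ij.2) (S.W ε)) S.φ) =
      PhiI S ε (tensorCLM (ContinuousLinearMap.id ℂ (ES (Fin k))) (S.W ε) S.φ) := by
    simp only [PhiI, smul_apply, sum_apply,
      ContinuousLinearMap.comp_apply, tensor_id_comp]
  rw [h]
  have h1 : ‖PhiI S ε (tensorCLM (ContinuousLinearMap.id ℂ (ES (Fin k))) (S.W ε) S.φ)‖ ≤
      ‖PhiI S ε‖ := by
    refine ((PhiI S ε).le_opNorm _).trans ?_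
    have := norm_id_tensor (ι₁ := Fin k) (S.W ε) (S.hW ε) S.φ
    rw [S.hφ] at this
    exact mul_le_of_le_one_right (norm_nonneg _) this
  have h2 := norm_PhiI_le hn S ε
  have h3 := norm_nonneg (PhiI S ε (tensorCLM (ContinuousLinearMap.id ℂ (ES (Fin k))) (S.W ε) S.φ))
  nlinarith

/-- there is a universal constant `C > 0` such that for every pure strategy
`S` for `G_Rad^{(n)}`:
`ω(S) ≤ ‖𝔼_ε Φ^i_S(ε)‖_op + C · σ^i_S · T2^{(n²)}(L)`, where `L` is the space of linear
maps `ℂ^k ⊗ ℂ^{k̃} → ℂ^r ⊗ ℂ^r` with the operator norm. -/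
theorem statement4 :
    ∃ C : ℝ, 0 < C ∧
      ∀ (n k k' r : ℕ), 2 ≤ n → 1 ≤ k → 1 ≤ k' → 1 ≤ r →
        ∀ S : PureStrategy n k k' r,
          value S ≤ ‖EavgV (PhiI S)‖
            + C * sigma (PhiI S)
              * T2With (n ^ 2) (ES (Fin k × Fin k') →L[ℂ] ES (Fin r × Fin r)) := by
  refine ⟨2, two_pos, fun n k k' r hn _ _ _ S => ?_⟩
  refine (value_le hn S).trans ?_
  have hcard : Fintype.card (Fin n × Fin n) = n ^ 2 := by simp [sq]
  have h := pisier (T2With_spec (n ^ 2) (ES (Fin k × Fin k') →L[ℂ] ES (Fin r × Fin r))).1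
    (typeTwo_of_T2With (ι := Fin n × Fin n) (n ^ 2) hcard
      (ES (Fin k × Fin k') →L[ℂ] ES (Fin r × Fin r)))
    (by rw [hcard]; nlinarith) (PhiI S)
  have he : EavgV (PhiI S) =
      (Fintype.card (Fin n × Fin n → Bool) : ℝ)⁻¹ • ∑ x, PhiI S x := by
    unfold EavgV
    have := Complex.coe_smul (E := ES (Fin k × Fin k') →L[ℂ] ES (Fin r × Fin r))
      (Fintype.card (Fin n × Fin n → Bool) : ℝ)⁻¹ (∑ x, PhiI S x)
    rw [Complex.ofReal_inv, Complex.ofReal_natCast] at this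
    exact this
  rw [he]
  exact h

end
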